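/- The Haar measure μ on the locally compact additive group (K̂, +), normalized so that μ(O) = 1, coincides with the 1-dimensional Hausdorff measure of the metric space (K̂, d_∞). -/

import Mathlib

open MeasureTheory
open scoped ENNReal Classical

noncomputable section

namespace ArtinCoding

variable (k : Type*) [Field k] [Fintype k]

/-- The field `K̂ = k((X⁻¹))` of formal Laurent series in `X⁻¹` over `k`, realized as the
field of formal Laurent series `k((t))` in the variable `t = X⁻¹`. -/
abbrev Khat := LaurentSeries k

variable {k}

/-- The absolute value `|f|_∞ = q^{-v_∞(f)}`, where `v_∞` is the order of vanishing in the
variable `t = X⁻¹` (so a nonzero polynomial in `X` has absolute value `≥ 1`). -/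
def absInf (f : Khat k) : ℝ :=
  if f = 0 then 0 else (Fintype.card k : ℝ) ^ (-f.order)

lemma absInf_nonneg (f : Khat k) : 0 ≤ absInf f := by
  unfold absInf
  split
  · exact le_refl 0
  · positivity

lemma absInf_eq_zero {f : Khat k} : absInf f = 0 ↔ f = 0 := by
  constructor
  · intro h
    by_contra hf
    have hq : (0:ℝ) < (Fintype.card k : ℝ) := by
      have := Fintype.card_pos (α := k); positivity
    rw [absInf, if_neg hf] at h
    exact absurd h (ne_of_gt (zpow_pos hq _))
  · intro h; simp [absInf, h]

lemma absInf_neg (f : Khat k) : absInf (-f) = absInf f := by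
  unfold absInf
  rw [neg_eq_zero, HahnSeries.order_neg]

lemma absInf_add_le (f g : Khat k) : absInf (f + g) ≤ max (absInf f) (absInf g) := by
  rcases eq_or_ne (f + g) 0 with h | h
  · rw [show absInf (f+g) = 0 by rw [absInf_eq_zero]; exact h]
    exact le_max_of_le_left (absInf_nonneg f)
  rcases eq_or_ne f 0 with hf | hf
  · simp [hf]
  rcases eq_or_ne g 0 with hg | hg
  · simp [hg]
  have hmin := HahnSeries.min_order_le_order_add h
  have hq : (1:ℝ) ≤ (Fintype.card k : ℝ) := by
    exact_mod_cast Nat.one_le_iff_ne_zero.mpr Fintype.card_ne_zero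
  rw [absInf, if_neg h]
  rcases le_total f.order g.order with hod | hod
  · rw [min_eq_left hod] at hmin
    refine le_max_of_le_left ?_
    rw [absInf, if_neg hf]
    exact zpow_le_zpow_right₀ hq (neg_le_neg hmin)
  · rw [min_eq_right hod] at hmin
    refine le_max_of_le_right ?_
    rw [absInf, if_neg hg]
    exact zpow_le_zpow_right₀ hq (neg_le_neg hmin)

/-- The metric `d_∞(f,g) = |f-g|_∞` on `K̂`. -/
noncomputable instance : MetricSpace (Khat k) where
  dist f g := absInf (f - g)
  dist_self f := by simp [absInf]
  dist_comm f g := by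
    have : g - f = -(f - g) := by ring
    show absInf (f - g) = absInf (g - f)
    rw [this, absInf_neg]
  dist_triangle f g h := by
    show absInf (f - h) ≤ absInf (f - g) + absInf (g - h)
    have key : absInf (f - h) ≤ max (absInf (f - g)) (absInf (g - h)) := by
      have : f - h = (f - g) + (g - h) := by ring
      rw [this]; exact absInf_add_le _ _
    exact key.trans (max_le_add_of_nonneg (absInf_nonneg _) (absInf_nonneg _))
  eq_of_dist_eq_zero := by
    intro f g h
    have : f - g = 0 := absInf_eq_zero.mp h
    exact sub_eq_zero.mp this

/- Make sure the topology coming from the metric `d_∞` is the one used everywhere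
(the valued-field uniformity on Laurent series induces the same topology). -/
instance (priority := 10000) : UniformSpace (Khat k) := PseudoMetricSpace.toUniformSpace
instance (priority := 10000) : TopologicalSpace (Khat k) := UniformSpace.toTopologicalSpace

instance : MeasurableSpace (Khat k) := borel _
instance : BorelSpace (Khat k) := ⟨rfl⟩

variable (k)

/-- The element `X⁻¹` of `K̂` (the uniformizer `t`). -/
def Xinv : Khat k := HahnSeries.single (1 : ℤ) (1 : k)

/-- The element `X` of `K̂`. -/
def Xel : Khat k := HahnSeries.single (-1 : ℤ) (1 : k)

/-- The valuation ring `O = k[[X⁻¹]] = {f : |f|_∞ ≤ 1}`. -/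
def Oball : Set (Khat k) := {f | absInf f ≤ 1}

/-- The set `X⁻¹O`, i.e. the maximal ideal of `O`. -/
def XinvO : Set (Khat k) := (fun f => Xinv k * f) '' Oball k

/-- The ring `A = k[X]` of polynomials in `X`, viewed as a subset of `K̂`. -/
def Aset : Set (Khat k) := Set.range fun p : Polynomial k => Polynomial.aeval (Xel k) p

/-- The constants `k ⊆ K̂`. -/
def kconsts : Set (Khat k) := Set.range (algebraMap k (Khat k))

/-- The set `A∖k` of nonconstant polynomials in `X`, viewed inside `K̂`. -/
def AmK : Set (Khat k) := Aset k \ kconsts k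

/-- The field `K = k(X)` of rational functions, viewed as a subset of `K̂`
(note that `k(X) = k(X⁻¹)` as a subfield of `K̂`). -/
def Kset : Set (Khat k) := Set.range fun r : RatFunc k => (r : LaurentSeries k)

/-- The set `ᶜK = K̂ ∖ K` of irrational elements. -/
def cK : Set (Khat k) := (Kset k)ᶜ

variable {k}

/-- The integer part `[f] ∈ A = k[X]` of `f ∈ K̂`: the sum of the terms of `f` with
nonpositive exponents in `t = X⁻¹`. -/
def intPart (f : Khat k) : Khat k :=
  ∑ i ∈ Finset.Icc (min f.order 0) 0, HahnSeries.single i (f.coeff i)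

/-- The fractional part `{f} = f - [f] ∈ X⁻¹O` of `f ∈ K̂`. -/
def fracPart (f : Khat k) : Khat k := f - intPart f

/-- The Artin map `Ψ(f) = 1/f - [1/f]`. -/
def ArtinPsi (f : Khat k) : Khat k := fracPart f⁻¹

/-- The Artin continued fraction digit `a_{n+1}(f) = [1/Ψⁿ(f)]` (for `n : ℕ`, so that
`digit 0 f = a₁(f) = [1/f]`). -/
def digit (n : ℕ) (f : Khat k) : Khat k := intPart ((ArtinPsi (k := k))^[n] f)⁻¹

variable (k)

/-- The set `J = ⋃_{a ∈ A∖k} (a + X⁻¹O)`. -/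
def Jset : Set (Khat k) := ⋃ a ∈ AmK k, (fun x => a + x) '' XinvO k

/-- The domain `Ω = (J ∩ ᶜK) × (X⁻¹O ∩ ᶜK)` of the natural extension of the Artin map. -/
def OmegaSet : Set (Khat k × Khat k) := (Jset k ∩ cK k) ×ˢ (XinvO k ∩ cK k)

variable {k}

/-- The map `Φ(ξ₋, ξ₊) = (1/ξ₋ - [1/ξ₊], Ψ(ξ₊))` (as a globally defined map on `K̂ × K̂`). -/
def PhiRaw (p : Khat k × Khat k) : Khat k × Khat k :=
  (p.1⁻¹ - intPart p.2⁻¹, ArtinPsi p.2)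

/-- The coding map `Θ'` sending `(ξ₋, ξ₊)` to the bilateral sequence `(c_n)_{n ∈ ℤ}` with
`c_n = a_n(ξ₊)` for `n ≥ 1` and `c_{-n} = a_{n+1}(-1/ξ₋)` for `n ≥ 0`. -/
def ThetaRaw (p : Khat k × Khat k) : ℤ → Khat k := fun n =>
  if 1 ≤ n then digit (n - 1).toNat p.2 else digit (-n).toNat (-p.1⁻¹)

variable (k)

/-- The density `q²/|ξ₊ - ξ₋|²_∞`. -/
def dens (p : Khat k × Khat k) : ℝ≥0∞ :=
  ENNReal.ofReal ((Fintype.card k : ℝ) ^ 2 * ((absInf (p.2 - p.1)) ^ 2)⁻¹)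

/-- The measure `m̂` on `Ω` given by `dm̂(ξ₋,ξ₊) = q² dμ(ξ₋) dμ(ξ₊)/|ξ₊ - ξ₋|²_∞`. -/
def mhat (μ : Measure (Khat k)) : Measure (Khat k × Khat k) :=
  (((μ.prod μ).withDensity (dens k))).restrict (OmegaSet k)

/-- The weight `ν(a) = |a|_∞⁻² = q^{-2 deg a}` for `a ∈ A∖k` (and `0` otherwise),
with values in `ℝ≥0∞`. -/
def nuE (a : Khat k) : ℝ≥0∞ :=
  if a ∈ AmK k then ENNReal.ofReal (((absInf a) ^ 2)⁻¹) else 0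

variable {k}

lemma one_lt_card : (1 : ℝ) < Fintype.card k := by
  exact_mod_cast Fintype.one_lt_card

lemma card_zpow_pos (n : ℤ) : (0 : ℝ) < (Fintype.card k : ℝ) ^ n :=
  zpow_pos (zero_lt_one.trans one_lt_card) n

lemma tendsto_card_zpow_neg :
    Filter.Tendsto (fun n : ℕ => (Fintype.card k : ℝ) ^ (-(n : ℤ))) Filter.atTop (nhds 0) := by
  simpa [Function.comp_def] using
    tendsto_inv_atTop_zero.comp (tendsto_pow_atTop_atTop_of_one_lt (one_lt_card (k := k)))

lemma absInf_le_zpow_iff (f : Khat k) (n : ℤ) :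
    absInf f ≤ (Fintype.card k : ℝ) ^ (-n) ↔ ∀ i < n, f.coeff i = 0 := by
  rcases eq_or_ne f 0 with rfl | hf
  · simp [absInf, (card_zpow_pos (k := k) _).le]
  · rw [absInf, if_neg hf, zpow_le_zpow_iff_right₀ one_lt_card, neg_le_neg_iff]
    refine ⟨fun h i hi => HahnSeries.coeff_eq_zero_of_lt_order (hi.trans_le h), fun h => ?_⟩
    by_contra! hlt
    exact hf (HahnSeries.coeff_order_eq_zero.mp (h _ hlt))

lemma zpow_le_absInf {f : Khat k} {n : ℤ} (h : f.coeff n ≠ 0) :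
    (Fintype.card k : ℝ) ^ (-n) ≤ absInf f := by
  have hf : f ≠ 0 := by rintro rfl; simp at h
  rw [absInf, if_neg hf, zpow_le_zpow_iff_right₀ one_lt_card, neg_le_neg_iff]
  exact HahnSeries.order_le_of_coeff_ne_zero h

lemma dist_eq_absInf (f g : Khat k) : dist f g = absInf (f - g) := rfl

lemma dist_le_zpow_iff (f g : Khat k) (n : ℤ) :
    dist f g ≤ (Fintype.card k : ℝ) ^ (-n) ↔ ∀ i < n, f.coeff i = g.coeff i := by
  rw [dist_eq_absInf, absInf_le_zpow_iff]
  simp [sub_eq_zero]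

lemma mem_closedBall_zpow_iff {f g : Khat k} {n : ℤ} :
    f ∈ Metric.closedBall g ((Fintype.card k : ℝ) ^ (-n)) ↔ ∀ i < n, f.coeff i = g.coeff i := by
  rw [Metric.mem_closedBall, dist_le_zpow_iff]

lemma Oball_eq_closedBall : Oball k = Metric.closedBall 0 1 := by
  ext f
  simp [Oball, dist_eq_absInf]

instance : IsUltrametricDist (Khat k) where
  dist_triangle_max f g h := by
    simpa only [dist_eq_absInf, sub_add_sub_cancel] using absInf_add_le (f - g) (g - h)

/-- Translation by a fixed element, as an isometry of `K̂`. -/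
def translation (x : Khat k) : Khat k ≃ᵢ Khat k where
  toEquiv := Equiv.addLeft x
  isometry_toFun := Isometry.of_dist_eq fun f g => by simp [dist_eq_absInf]

instance : SecondCountableTopology (Khat k) := by
  refine Metric.secondCountable_of_almost_dense_set fun ε hε => ?_
  refine ⟨Set.range (HahnSeries.ofFinsupp : (ℤ →₀ k) → Khat k), Set.countable_range _,
    fun f => ?_⟩
  obtain ⟨n, hn⟩ := (tendsto_card_zpow_neg (k := k)).eventually_lt_const hε |>.exists
  refine ⟨_, ⟨Finsupp.onFinset (Finset.Ico f.order n)
    (fun i => if i < n then f.coeff i else 0) fun i hi => ?_, rfl⟩,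
    ((dist_le_zpow_iff _ _ _).2 fun i hi => ?_).trans hn.le⟩
  · rw [Finset.mem_Ico]
    have hin : i < n := by by_contra h; simp [h] at hi
    rw [if_pos hin] at hi
    exact ⟨HahnSeries.order_le_of_coeff_ne_zero hi, hin⟩
  · simp [hi]

/-- The closed balls of `K̂` whose radius is an integral power of `q`. -/
def zpowBalls (k : Type*) [Field k] [Fintype k] : Set (Set (Khat k)) :=
  {s | ∃ (x : Khat k) (n : ℤ), Metric.closedBall x ((Fintype.card k : ℝ) ^ (-n)) = s}

lemma isTopologicalBasis_zpowBalls : TopologicalSpace.IsTopologicalBasis (zpowBalls k) := by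
  refine TopologicalSpace.isTopologicalBasis_of_isOpen_of_nhds ?_ fun x U hx hU => ?_
  · rintro _ ⟨x, n, rfl⟩
    exact IsUltrametricDist.isOpen_closedBall x (card_zpow_pos _).ne'
  · obtain ⟨ε, hε, hεU⟩ := Metric.isOpen_iff.1 hU x hx
    obtain ⟨n, hn⟩ := (tendsto_card_zpow_neg (k := k)).eventually_lt_const hε |>.exists
    exact ⟨_, ⟨x, n, rfl⟩, Metric.mem_closedBall_self (card_zpow_pos _).le,
      (Metric.closedBall_subset_ball hn).trans hεU⟩

lemma isPiSystem_zpowBalls : IsPiSystem (zpowBalls k) := by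
  rintro _ ⟨x, m, rfl⟩ _ ⟨y, n, rfl⟩ ⟨z, hzx, hzy⟩
  refine ⟨z, max m n, ?_⟩
  ext f
  simp only [Set.mem_inter_iff, mem_closedBall_zpow_iff] at hzx hzy ⊢
  grind

lemma iUnion_closedBall_zpow :
    ⋃ n : ℕ, Metric.closedBall (0 : Khat k) ((Fintype.card k : ℝ) ^ (-(-(n : ℤ)))) = Set.univ := by
  refine Set.eq_univ_of_forall fun f => Set.mem_iUnion.2 ?_
  obtain ⟨n, hn⟩ := pow_unbounded_of_one_lt (dist f 0) (one_lt_card (k := k))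
  exact ⟨n, by simpa using hn.le⟩

section Invariant

variable {μ : Measure (Khat k)} (hinv : ∀ x : Khat k, Measure.map (fun y => x + y) μ = μ)

include hinv

lemma measure_closedBall_eq_zero_center (x : Khat k) (r : ℝ) :
    μ (Metric.closedBall x r) = μ (Metric.closedBall 0 r) := by
  have hm : Measurable fun y : Khat k => x + y := (translation x).continuous.measurable
  conv_lhs => rw [← hinv x]
  rw [Measure.map_apply hm Metric.isClosed_closedBall.measurableSet]
  congr 1
  ext f
  simp [dist_eq_absInf]

lemma measure_closedBall_zpow_succ (n : ℤ) :
    μ (Metric.closedBall 0 ((Fintype.card k : ℝ) ^ (-n))) =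
      Fintype.card k * μ (Metric.closedBall 0 ((Fintype.card k : ℝ) ^ (-(n + 1)))) := by
  have hU : Metric.closedBall (0 : Khat k) ((Fintype.card k : ℝ) ^ (-n)) =
      ⋃ c : k, Metric.closedBall (HahnSeries.single n c : Khat k)
        ((Fintype.card k : ℝ) ^ (-(n + 1))) := by
    ext f
    simp only [Set.mem_iUnion, mem_closedBall_zpow_iff]
    refine ⟨fun h => ⟨f.coeff n, fun i hi => ?_⟩, fun ⟨c, hc⟩ i hi => ?_⟩
    · rcases (Int.lt_add_one_iff.1 hi).eq_or_lt with rfl | hi'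
      · simp
      · simp [h i hi', HahnSeries.coeff_single_of_ne hi'.ne]
    · simp [hc i (by lia), HahnSeries.coeff_single_of_ne hi.ne]
  rw [hU, measure_iUnion]
  · simp [measure_closedBall_eq_zero_center hinv (HahnSeries.single n _)]
  · refine fun c d hcd => Set.disjoint_left.2 fun f hc hd => hcd ?_
    rw [mem_closedBall_zpow_iff] at hc hd
    simpa using (hc n (by lia)).symm.trans (hd n (by lia))
  · exact fun c => Metric.isClosed_closedBall.measurableSet

lemma measure_closedBall_zpow (hO : μ (Oball k) = 1) (x : Khat k) (n : ℤ) :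
    μ (Metric.closedBall x ((Fintype.card k : ℝ) ^ (-n))) =
      ENNReal.ofReal ((Fintype.card k : ℝ) ^ (-n)) := by
  have hq : (Fintype.card k : ℝ) ≠ 0 := (zero_lt_one.trans one_lt_card).ne'
  have hstep (n : ℤ) : ENNReal.ofReal ((Fintype.card k : ℝ) ^ (-n)) =
      Fintype.card k * ENNReal.ofReal ((Fintype.card k : ℝ) ^ (-(n + 1))) := by
    rw [← ENNReal.ofReal_natCast, ← ENNReal.ofReal_mul (Nat.cast_nonneg _),
      ← zpow_one_add₀ hq, show 1 + -(n + 1) = -n by ring]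
  rw [measure_closedBall_eq_zero_center hinv]
  induction n using Int.induction_on with
  | zero => simpa [Oball_eq_closedBall] using hO
  | succ n ih =>
    rw [measure_closedBall_zpow_succ hinv, hstep] at ih
    exact (ENNReal.mul_right_inj (by simp) (ENNReal.natCast_ne_top _)).1 ih
  | pred n ih =>
    rw [measure_closedBall_zpow_succ hinv, hstep, sub_add_cancel, ih]

lemma measure_le_ediam (hO : μ (Oball k) = 1) {s : Set (Khat k)} (hs : Metric.ediam s ≤ 1) :
    μ s ≤ Metric.ediam s := by
  rcases s.eq_empty_or_nonempty with rfl | ⟨x, hx⟩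
  · simp
  have hball (n : ℕ) (h : ∀ m < n, ∀ y ∈ s, ∀ z ∈ s, y.coeff (m : ℤ) = z.coeff m) :
      μ s ≤ ENNReal.ofReal ((Fintype.card k : ℝ) ^ (-(n : ℤ))) := by
    rw [← measure_closedBall_zpow hinv hO x]
    refine measure_mono fun y hy => mem_closedBall_zpow_iff.2 fun i hi => ?_
    rcases le_or_gt 0 i with h0 | h0
    · lift i to ℕ using h0
      exact h i (by exact_mod_cast hi) y hy x hx
    · have hd : dist y x ≤ (Fintype.card k : ℝ) ^ (-(0 : ℤ)) := by
        have := (Metric.edist_le_ediam_of_mem hy hx).trans hs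
        rwa [edist_dist, ENNReal.ofReal_le_one] at this
      exact (dist_le_zpow_iff _ _ _).1 hd i h0
  by_cases hex : ∃ n : ℕ, ∃ y ∈ s, ∃ z ∈ s, y.coeff (n : ℤ) ≠ z.coeff n
  · obtain ⟨y, hy, z, hz, hyz⟩ := Nat.find_spec hex
    refine (hball (Nat.find hex) fun m hm y hy z hz => ?_).trans
      (le_trans ?_ (Metric.edist_le_ediam_of_mem hy hz))
    · by_contra hne
      exact Nat.find_min hex hm ⟨y, hy, z, hz, hne⟩
    · rw [edist_dist, dist_eq_absInf]
      exact ENNReal.ofReal_le_ofReal (zpow_le_absInf (by simpa [sub_eq_zero] using hyz))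
  · push Not at hex
    have hlim := ENNReal.tendsto_ofReal (tendsto_card_zpow_neg (k := k))
    rw [ENNReal.ofReal_zero] at hlim
    exact (ge_of_tendsto' hlim fun n => hball n fun m _ => hex m).trans bot_le

lemma eq_of_translation_invariant {ν : Measure (Khat k)}
    (hinv' : ∀ x : Khat k, Measure.map (fun y => x + y) ν = ν)
    (hμ : μ (Oball k) = 1) (hν : ν (Oball k) = 1) : μ = ν := by
  refine Measure.ext_of_generateFrom_of_iUnion (zpowBalls k) _
    isTopologicalBasis_zpowBalls.borel_eq_generateFrom isPiSystem_zpowBalls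
    iUnion_closedBall_zpow (fun n => ⟨0, -n, rfl⟩) (fun n => ?_) ?_
  · rw [measure_closedBall_zpow hinv hμ]
    exact ENNReal.ofReal_ne_top
  · rintro _ ⟨x, n, rfl⟩
    rw [measure_closedBall_zpow hinv hμ, measure_closedBall_zpow hinv' hν]

end Invariant

lemma hausdorffMeasure_Oball_le_one : Measure.hausdorffMeasure 1 (Oball k) ≤ 1 := by
  let t (n : ℕ) (c : Fin n → k) : Set (Khat k) :=
    {f | f ∈ Oball k ∧ ∀ i : Fin n, f.coeff (i : ℤ) = c i}
  have hlim := ENNReal.tendsto_ofReal (tendsto_card_zpow_neg (k := k))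
  rw [ENNReal.ofReal_zero] at hlim
  have hO (f : Khat k) (hf : f ∈ Oball k) (i : ℤ) (hi : i < 0) : f.coeff i = 0 :=
    (absInf_le_zpow_iff f 0).1 (by simpa [Oball] using hf) i hi
  have hdiam (n : ℕ) (c : Fin n → k) :
      Metric.ediam (t n c) ≤ ENNReal.ofReal ((Fintype.card k : ℝ) ^ (-(n : ℤ))) := by
    refine Metric.ediam_le fun f hf g hg => ?_
    rw [edist_dist]
    refine ENNReal.ofReal_le_ofReal ((dist_le_zpow_iff _ _ _).2 fun i hi => ?_)
    rcases le_or_gt 0 i with h0 | h0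
    · lift i to ℕ using h0
      have hin : i < n := by exact_mod_cast hi
      exact (hf.2 ⟨i, hin⟩).trans (hg.2 ⟨i, hin⟩).symm
    · rw [hO f hf.1 i h0, hO g hg.1 i h0]
  refine (Measure.hausdorffMeasure_le_liminf_sum 1 (Oball k) _ hlim t
    (Filter.Eventually.of_forall hdiam) (Filter.Eventually.of_forall fun n f hf =>
      Set.mem_iUnion.2 ⟨fun i => f.coeff (i : ℤ), hf, fun _ => rfl⟩)).trans ?_
  refine Filter.liminf_le_of_le (by isBoundedDefault) fun b hb => ?_
  obtain ⟨n, hn⟩ := hb.exists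
  refine hn.trans ((Finset.sum_le_sum fun c _ => by
    simpa only [ENNReal.rpow_one] using hdiam n c).trans ?_)
  have hq : (Fintype.card k : ℝ) ≠ 0 := (zero_lt_one.trans one_lt_card).ne'
  rw [Finset.sum_const, nsmul_eq_mul, ← ENNReal.ofReal_natCast,
    ← ENNReal.ofReal_mul (Nat.cast_nonneg _)]
  simp [hq]

/-- The Haar measure `μ` on `(K̂, +)` (i.e. any translation-invariant Borel
measure) normalized by `μ(O) = 1` coincides with the `1`-dimensional Hausdorff measure of
`(K̂, d_∞)`. -/
theorem statement_3 (k : Type*) [Field k] [Fintype k] (μ : MeasureTheory.Measure (Khat k))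
    (hinv : ∀ x : Khat k, MeasureTheory.Measure.map (fun y => x + y) μ = μ)
    (hO : μ (Oball k) = 1) :
    μ = (MeasureTheory.Measure.hausdorffMeasure 1 : MeasureTheory.Measure (Khat k)) := by
  have hinvH (x : Khat k) :
      Measure.map (fun y => x + y) (Measure.hausdorffMeasure 1 : Measure (Khat k)) =
        Measure.hausdorffMeasure 1 :=
    (translation x).map_hausdorffMeasure 1
  have hle : μ ≤ Measure.hausdorffMeasure 1 :=
    Measure.le_hausdorffMeasure 1 μ 1 one_pos fun s hs => by
      simpa only [ENNReal.rpow_one] using measure_le_ediam hinv hO hs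
  exact eq_of_translation_invariant hinv hinvH hO
    (hausdorffMeasure_Oball_le_one.antisymm (hO ▸ hle (Oball k)))

end ArtinCoding
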